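/- In the wedge product W_{p,q−1} = C_p ⋈ Δ_{q−1} of a p-gon and a (q−1)-simplex, every face corresponding to a vector (j̄_0, …, j̄_{p−1}) with j_k ∈ Z_q and j̄_k = Z_q \ {j_k} is a p-gon (a 2-dimensional face with p vertices and p edges). The number of such p-gon faces is q^p. -/

import Mathlib

open Matrix Set

noncomputable section

def setDim {V : Type*} [AddCommGroup V] [Module ℝ V] (s : Set V) : ℕ :=
  Module.finrank ℝ (affineSpan ℝ s).direction

def IsFaceOf {V : Type*} [AddCommGroup V] [Module ℝ V] (F P : Set V) : Prop :=
  F ⊆ P ∧ ∃ (c : V →ₗ[ℝ] ℝ) (b : ℝ), (∀ x ∈ P, c x ≤ b) ∧ F = {x ∈ P | c x = b}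

def IsVertexOf {V : Type*} [AddCommGroup V] [Module ℝ V] (v : V) (P : Set V) : Prop :=
  IsFaceOf {v} P

def IsFacetOf {V : Type*} [AddCommGroup V] [Module ℝ V] (F P : Set V) : Prop :=
  IsFaceOf F P ∧ F.Nonempty ∧ setDim F + 1 = setDim P

/-- Affine embeddings preserve and reflect the face relation. -/
theorem isFaceOf_image_iff {V V' : Type*} [AddCommGroup V] [Module ℝ V] [AddCommGroup V']
    [Module ℝ V'] (f : V →ᵃ[ℝ] V') (g : V' →ₗ[ℝ] V) (hgf : ∀ x, g (f x) = x) (F P : Set V) :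
    IsFaceOf (f '' F) (f '' P) ↔ IsFaceOf F P := by
  have hinj : Function.Injective f := Function.LeftInverse.injective hgf
  unfold IsFaceOf
  rw [Set.image_subset_image_iff hinj]
  refine and_congr_right fun _ => ⟨?_, ?_⟩
  · rintro ⟨c, b, hle, hF⟩
    have key : ∀ x, c (f x) = (c ∘ₗ f.linear) x + c (f 0) := fun x => by
      have h := f.map_vadd 0 x
      simp only [vadd_eq_add, add_zero] at h
      simp [h]
    refine ⟨c ∘ₗ f.linear, b - c (f 0), fun x hx => ?_, ?_⟩
    · linarith [hle (f x) (Set.mem_image_of_mem f hx), key x]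
    · ext x
      rw [← hinj.mem_set_image, hF, Set.mem_ofPred_eq, Set.mem_ofPred_eq, hinj.mem_set_image, key x,
        eq_sub_iff_add_eq]
  · rintro ⟨c, b, hle, hF⟩
    refine ⟨c ∘ₗ g, b, ?_, ?_⟩
    · rintro _ ⟨x, hx, rfl⟩
      simpa [hgf] using hle x hx
    · ext z
      constructor
      · rintro ⟨x, hx, rfl⟩
        rw [hF] at hx
        exact ⟨⟨x, hx.1, rfl⟩, by simpa [hgf] using hx.2⟩
      · rintro ⟨⟨x, hx, rfl⟩, hz⟩
        refine ⟨x, ?_, rfl⟩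
        rw [hF]
        exact ⟨hx, by simpa [hgf] using hz⟩

theorem setDim_image {V V' : Type*} [AddCommGroup V] [Module ℝ V] [AddCommGroup V']
    [Module ℝ V'] (f : V →ᵃ[ℝ] V') (hf : Function.Injective f) (s : Set V) :
    setDim (f '' s) = setDim s := by
  unfold setDim
  rw [← AffineSubspace.map_span, AffineSubspace.map_direction]
  exact (Submodule.equivMapOfInjective f.linear (f.linear_injective_iff.2 hf) _).finrank_eq.symm

theorem setOf_isVertexOf_image {V V' : Type*} [AddCommGroup V] [Module ℝ V] [AddCommGroup V']
    [Module ℝ V'] (f : V →ᵃ[ℝ] V') (g : V' →ₗ[ℝ] V) (hgf : ∀ x, g (f x) = x) (P : Set V) :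
    {v | IsVertexOf v (f '' P)} = f '' {v | IsVertexOf v P} := by
  ext v
  constructor
  · intro hv
    obtain ⟨x, -, rfl⟩ := hv.1 (Set.mem_singleton v)
    refine ⟨x, (isFaceOf_image_iff f g hgf {x} P).1 ?_, rfl⟩
    rwa [Set.image_singleton]
  · rintro ⟨x, hx, rfl⟩
    have := (isFaceOf_image_iff f g hgf {x} P).2 hx
    rwa [Set.image_singleton] at this

theorem setOf_edges_image {V V' : Type*} [AddCommGroup V] [Module ℝ V] [AddCommGroup V']
    [Module ℝ V'] (f : V →ᵃ[ℝ] V') (g : V' →ₗ[ℝ] V) (hgf : ∀ x, g (f x) = x) (P : Set V) :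
    {e | IsFaceOf e (f '' P) ∧ e.Nonempty ∧ setDim e = 1} =
      Set.image f '' {e | IsFaceOf e P ∧ e.Nonempty ∧ setDim e = 1} := by
  have hinj : Function.Injective f := Function.LeftInverse.injective hgf
  ext e
  constructor
  · rintro ⟨he, hne, hd⟩
    obtain ⟨F, -, rfl⟩ := Set.subset_image_iff.1 he.1
    exact ⟨F, ⟨(isFaceOf_image_iff f g hgf F P).1 he, hne.of_image,
      by rwa [setDim_image f hinj] at hd⟩, rfl⟩
  · rintro ⟨F, ⟨hF, hne, hd⟩, rfl⟩
    exact ⟨(isFaceOf_image_iff f g hgf F P).2 hF, hne.image f, by rwa [setDim_image f hinj]⟩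

/-- The facet hyperplanes of a polytope with the origin in its interior have no common point. -/
theorem not_forall_dotProduct_eq_one {ι κ : Type*} [Nonempty ι] [Fintype κ] (a : ι → κ → ℝ)
    (hbd : Bornology.IsBounded {x | ∀ i, a i ⬝ᵥ x ≤ 1}) (v : κ → ℝ) :
    ¬ ∀ i, a i ⬝ᵥ v = 1 := by
  intro h
  obtain ⟨R, hR⟩ := hbd.exists_norm_le
  have hv : 0 < ‖v‖ := by
    rw [norm_pos_iff]
    rintro rfl
    simpa using h (Classical.arbitrary ι)
  have hR0 : 0 ≤ R := le_trans (norm_nonneg _) (hR 0 (by simp))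
  have hmem : (-((R + 1) / ‖v‖)) • v ∈ {x | ∀ i, a i ⬝ᵥ x ≤ 1} := fun i => by
    rw [dotProduct_smul, h i, smul_eq_mul, mul_one]
    have : 0 ≤ (R + 1) / ‖v‖ := by positivity
    linarith
  have := hR _ hmem
  rw [norm_smul, norm_neg, Real.norm_of_nonneg (by positivity), div_mul_cancel₀ _ hv.ne'] at this
  linarith

/-- Moving a little from `v` in a direction along which every active constraint is constant
stays in the polyhedron. -/
theorem exists_pos_forall_dotProduct_le {ι κ : Type*} [Finite ι] [Fintype κ] (a : ι → κ → ℝ)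
    {v u : κ → ℝ} (hv : ∀ i, a i ⬝ᵥ v ≤ 1) (hu : ∀ i, a i ⬝ᵥ v = 1 → a i ⬝ᵥ u = 0) :
    ∃ ε : ℝ, 0 < ε ∧ ∀ i, a i ⬝ᵥ (v + ε • u) ≤ 1 := by
  have hev : ∀ i, ∀ᶠ ε : ℝ in nhdsWithin 0 (Set.Ioi 0), a i ⬝ᵥ (v + ε • u) ≤ 1 := fun i => by
    simp only [dotProduct_add, dotProduct_smul, smul_eq_mul]
    rcases (hv i).lt_or_eq with h | h
    · have hc : ContinuousAt (fun ε : ℝ => a i ⬝ᵥ v + ε * (a i ⬝ᵥ u)) 0 := by fun_prop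
      have hlt : ∀ᶠ ε : ℝ in nhds 0, a i ⬝ᵥ v + ε * (a i ⬝ᵥ u) < 1 :=
        hc.eventually_lt continuousAt_const (by simpa using h)
      exact (hlt.filter_mono nhdsWithin_le_nhds).mono fun ε hε => hε.le
    · exact Filter.Eventually.of_forall fun ε => by rw [hu i h, h]; simp
  obtain ⟨ε, h, hε⟩ := ((Filter.eventually_all.2 hev).and self_mem_nhdsWithin).exists
  exact ⟨ε, hε, h⟩

theorem eq_of_dotProduct_eq_one {a a' u v : Fin 2 → ℝ} (huv : u ≠ v) (hu : a ⬝ᵥ u = 1)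
    (hv : a ⬝ᵥ v = 1) (hu' : a' ⬝ᵥ u = 1) (hv' : a' ⬝ᵥ v = 1) : a = a' := by
  simp only [dotProduct, Fin.sum_univ_two] at hu hv hu' hv'
  have hdet : u 0 * v 1 - u 1 * v 0 ≠ 0 := fun h => huv <| by
    ext k
    fin_cases k
    · simp only [Fin.zero_eta]
      linear_combination (-u 0) * hv + v 0 * hu + a 1 * h
    · simp only [Fin.mk_one]
      linear_combination (-u 1) * hv + v 1 * hu - a 0 * h
  ext k
  fin_cases k
  · refine mul_right_cancel₀ hdet ?_
    simp only [Fin.zero_eta]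
    linear_combination v 1 * (hu - hu') - u 1 * (hv - hv')
  · refine mul_right_cancel₀ hdet ?_
    simp only [Fin.mk_one]
    linear_combination u 0 * (hv - hv') - v 0 * (hu - hu')

/-- A vertex of a polygon lies on two different edge lines. -/
theorem exists_two_active_of_isVertexOf {ι : Type*} [Finite ι] (a : ι → Fin 2 → ℝ)
    {v : Fin 2 → ℝ} (hv : IsVertexOf v {x | ∀ i, a i ⬝ᵥ x ≤ 1}) :
    ∃ i k, i ≠ k ∧ a i ⬝ᵥ v = 1 ∧ a k ⬝ᵥ v = 1 := by
  by_contra! hcon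
  have hvC : ∀ i, a i ⬝ᵥ v ≤ 1 := hv.1 (Set.mem_singleton v)
  obtain ⟨u, hu0, hu⟩ : ∃ u ≠ 0, ∀ i, a i ⬝ᵥ v = 1 → a i ⬝ᵥ u = 0 := by
    by_cases h : ∃ i, a i ⬝ᵥ v = 1
    · obtain ⟨i, hi⟩ := h
      obtain ⟨u, hu0, hu⟩ := exists_ne_zero_dotProduct_eq_zero (a i)
      refine ⟨u, hu0, fun k hk => ?_⟩
      by_cases hik : i = k
      · rwa [← hik, dotProduct_comm]
      · exact absurd hk (hcon i k hik hi)
    · exact ⟨1, one_ne_zero, fun i hi => absurd ⟨i, hi⟩ h⟩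
  obtain ⟨ε, hε, hmem⟩ := exists_pos_forall_dotProduct_le a hvC hu
  obtain ⟨δ, hδ, hmem'⟩ := exists_pos_forall_dotProduct_le a (u := -u) hvC
    fun i hi => by rw [dotProduct_neg, hu i hi, neg_zero]
  obtain ⟨-, c, β, hle, hF⟩ := hv
  have hcv : c v = β := ((Set.ext_iff.1 hF v).1 (Set.mem_singleton v)).2
  have h1 := hle _ hmem
  have h2 := hle _ hmem'
  simp only [map_add, map_smul, map_neg, smul_eq_mul, hcv] at h1 h2
  have hcu : c u = 0 := by
    apply le_antisymm
    · by_contra! h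
      nlinarith [mul_pos hε h]
    · by_contra! h
      nlinarith [mul_pos hδ (neg_pos.2 h)]
  have : v + ε • u ∈ ({v} : Set (Fin 2 → ℝ)) := by
    rw [hF]
    exact ⟨hmem, by simp [hcv, hcu]⟩
  simp only [Set.mem_singleton_iff, add_eq_left, smul_eq_zero] at this
  exact this.elim hε.ne' hu0

theorem ncard_setOf_isVertexOf_polygon (p : ℕ) [NeZero p] (hp : 3 ≤ p) (a : ZMod p → Fin 2 → ℝ)
    (C : Set (Fin 2 → ℝ)) (hC : C = {x | ∀ i, a i ⬝ᵥ x ≤ 1}) (hCbd : Bornology.IsBounded C)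
    (hCinj : Function.Injective fun i => {x ∈ C | a i ⬝ᵥ x = 1})
    (hCcyc : ∀ i i' : ZMod p,
      (∃ v, {x ∈ C | a i ⬝ᵥ x = 1} ∩ {x ∈ C | a i' ⬝ᵥ x = 1} = {v}) ↔
        (i' = i + 1 ∨ i = i' + 1)) :
    {v | IsVertexOf v C}.ncard = p := by
  have hinter : ∀ i k v, i ≠ k → v ∈ C → a i ⬝ᵥ v = 1 → a k ⬝ᵥ v = 1 →
      {x ∈ C | a i ⬝ᵥ x = 1} ∩ {x ∈ C | a k ⬝ᵥ x = 1} = {v} := by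
    intro i k v hik hv hi hk
    ext u
    constructor
    · rintro ⟨⟨-, hui⟩, -, huk⟩
      by_contra huv
      exact hik (hCinj (by simp only [eq_of_dotProduct_eq_one huv hui hi huk hk]))
    · rintro rfl
      exact ⟨⟨hv, hi⟩, hv, hk⟩
  have hadj : ∀ i k v, i ≠ k → v ∈ C → a i ⬝ᵥ v = 1 → a k ⬝ᵥ v = 1 → k = i + 1 ∨ i = k + 1 :=
    fun i k v hik hv hi hk => (hCcyc i k).1 ⟨v, hinter i k v hik hv hi hk⟩
  choose v hv using fun i : ZMod p => (hCcyc i (i + 1)).2 (Or.inl rfl)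
  have hvmem : ∀ i, v i ∈ C ∧ a i ⬝ᵥ v i = 1 ∧ a (i + 1) ⬝ᵥ v i = 1 := fun i => by
    have h : v i ∈ {x ∈ C | a i ⬝ᵥ x = 1} ∩ {x ∈ C | a (i + 1) ⬝ᵥ x = 1} := by rw [hv i]; rfl
    exact ⟨h.1.1, h.1.2, h.2.2⟩
  have hrange : {v | IsVertexOf v C} = Set.range v := by
    ext x
    constructor
    · intro hx
      have hxC : x ∈ C := hx.1 (Set.mem_singleton x)
      obtain ⟨i, k, hik, hi, hk⟩ := exists_two_active_of_isVertexOf a (hC ▸ hx)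
      have hxik := hinter i k x hik hxC hi hk
      rcases hadj i k x hik hxC hi hk with rfl | rfl
      · exact ⟨i, Set.singleton_injective ((hv i).symm.trans hxik)⟩
      · exact ⟨k, Set.singleton_injective ((hv k).symm.trans (Set.inter_comm _ _ ▸ hxik))⟩
    · rintro ⟨i, rfl⟩
      have hle : ∀ x ∈ C, ∀ k, a k ⬝ᵥ x ≤ 1 := fun x hx => by rwa [hC] at hx
      refine ⟨Set.singleton_subset_iff.2 (hvmem i).1,
        dotProductBilin ℝ ℝ (a i) + dotProductBilin ℝ ℝ (a (i + 1)), 2, fun x hx => ?_, ?_⟩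
      · have := hle x hx i
        have := hle x hx (i + 1)
        simp only [LinearMap.add_apply, dotProductBilin_apply_apply]
        linarith
      · rw [← hv i]
        ext x
        simp only [LinearMap.add_apply, dotProductBilin_apply_apply]
        constructor
        · rintro ⟨⟨hx, h1⟩, -, h2⟩
          exact ⟨hx, by rw [h1, h2]; norm_num⟩
        · rintro ⟨hx, h⟩
          have := hle x hx i
          have := hle x hx (i + 1)
          exact ⟨⟨hx, by linarith⟩, hx, by linarith⟩
  have hne1 : (1 : ZMod p) ≠ 0 := by
    have : Fact (1 < p) := ⟨by omega⟩
    exact one_ne_zero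
  have hsucc : ∀ i, v i ≠ v (i + 1) := by
    intro i h
    obtain ⟨hC0, h0, h1⟩ := hvmem i
    have h2 := (hvmem (i + 1)).2.2
    rw [← h] at h2
    have hp3 : p = 3 := by
      have h3 : ((3 : ℕ) : ZMod p) = 0 := by
        by_cases hi : i = i + 1 + 1
        · have h20 : ((2 : ℕ) : ZMod p) = 0 := by push_cast; linear_combination -hi
          have := Nat.le_of_dvd (by norm_num) ((ZMod.natCast_eq_zero_iff 2 p).1 h20)
          omega
        · rcases hadj i (i + 1 + 1) (v i) hi hC0 h0 h2 with h | h
          · exact absurd (by linear_combination h) hne1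
          · push_cast
            linear_combination -h
      have := Nat.le_of_dvd (by norm_num) ((ZMod.natCast_eq_zero_iff 3 p).1 h3)
      omega
    subst hp3
    refine not_forall_dotProduct_eq_one a (hC ▸ hCbd) (v i) fun k => ?_
    have hk : ∀ i k : ZMod 3, k = i ∨ k = i + 1 ∨ k = i + 1 + 1 := by decide
    rcases hk i k with rfl | rfl | rfl <;> assumption
  have hvinj : Function.Injective v := by
    intro i k hik
    by_contra hne
    obtain ⟨hC0, h0, -⟩ := hvmem i
    have h1 := (hvmem k).2.1
    rw [← hik] at h1
    rcases hadj i k (v i) hne hC0 h0 h1 with rfl | rfl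
    · exact hsucc i hik
    · exact hsucc k hik.symm
  rw [hrange, ← Set.image_univ, Set.ncard_image_of_injective _ hvinj, Set.ncard_univ,
    Nat.card_zmod]

/-- The embedding of the plane of a polygon whose image contains the face of the wedge product
with `y_i` on the ray spanned by `w i`. -/
def wedgeEmbedding {ι κ E : Type*} [Fintype κ] [AddCommGroup E] [Module ℝ E] (a : ι → κ → ℝ)
    (w : ι → E) : (κ → ℝ) →ᵃ[ℝ] (κ → ℝ) × (ι → E) where
  toFun x := (x, fun i => (1 - a i ⬝ᵥ x) • w i)
  linear := LinearMap.prod LinearMap.id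
    (LinearMap.pi fun i => (-dotProductBilin ℝ ℝ (a i)).smulRight (w i))
  map_vadd' x v := by
    ext i
    · simp
    · change (1 - a i ⬝ᵥ (v + x)) • w i = -(a i ⬝ᵥ v) • w i + (1 - a i ⬝ᵥ x) • w i
      rw [dotProduct_add]
      module

theorem wedgeEmbedding_apply {ι κ E : Type*} [Fintype κ] [AddCommGroup E] [Module ℝ E]
    (a : ι → κ → ℝ) (w : ι → E) (x : κ → ℝ) :
    wedgeEmbedding a w x = (x, fun i => (1 - a i ⬝ᵥ x) • w i) := rfl

/-- If `w` is the only point of a polytope on all facets but the `j`-th, then the `j`-th facet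
inequality is strict at `w`, and the other facet normals span. -/
theorem vertex_opposite_facet {ι κ : Type*} [Finite ι] [Fintype κ] (b : ι → κ → ℝ)
    (hbd : Bornology.IsBounded {y | ∀ j, b j ⬝ᵥ y ≤ 1}) {j : ι} {w : κ → ℝ}
    (hw : {y ∈ {y | ∀ j, b j ⬝ᵥ y ≤ 1} | ∀ j', j' ≠ j → b j' ⬝ᵥ y = 1} = {w}) :
    (∀ j', j' ≠ j → b j' ⬝ᵥ w = 1) ∧ b j ⬝ᵥ w < 1 ∧
      ∀ u, (∀ j', j' ≠ j → b j' ⬝ᵥ u = 0) → u = 0 := by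
  obtain ⟨hle, heq⟩ := (Set.ext_iff.1 hw w).2 (Set.mem_singleton w)
  have hlt : b j ⬝ᵥ w < 1 := by
    refine (hle j).lt_of_ne fun h => ?_
    have : Nonempty ι := ⟨j⟩
    refine not_forall_dotProduct_eq_one b hbd w fun j' => ?_
    by_cases hj : j' = j
    · rwa [hj]
    · exact heq j' hj
  refine ⟨heq, hlt, fun u hu => ?_⟩
  obtain ⟨ε, hε, hmem⟩ := exists_pos_forall_dotProduct_le b (u := u) hle fun j' hj' =>
    hu j' (by rintro rfl; exact hlt.ne hj')
  have : w + ε • u ∈ ({w} : Set (κ → ℝ)) := by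
    rw [← hw]
    refine ⟨hmem, fun j' hj' => ?_⟩
    rw [dotProduct_add, dotProduct_smul, hu j' hj', heq j' hj', smul_zero, add_zero]
  simp only [Set.mem_singleton_iff, add_eq_left, smul_eq_zero] at this
  exact this.resolve_left hε.ne'

/-- The set cut out of a wedge product by making all inequalities but one in each block tight is
an affine copy of the first factor. -/
theorem wedge_face_eq_image {ι κ κ' J : Type*} [Fintype κ] [Fintype κ'] (a : ι → κ → ℝ)
    (b : J → κ' → ℝ) (jv : ι → J) (w : J → κ' → ℝ)
    (hw1 : ∀ j j', j' ≠ j → b j' ⬝ᵥ w j = 1) (hw2 : ∀ j, b j ⬝ᵥ w j < 1)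
    (hw3 : ∀ j u, (∀ j', j' ≠ j → b j' ⬝ᵥ u = 0) → u = 0) :
    {z ∈ {z : (κ → ℝ) × (ι → κ' → ℝ) | ∀ i j, a i ⬝ᵥ z.1 + b j ⬝ᵥ z.2 i ≤ 1} |
        ∀ i, ∀ j', j' ≠ jv i → a i ⬝ᵥ z.1 + b j' ⬝ᵥ z.2 i = 1} =
      wedgeEmbedding a (fun i => w (jv i)) '' {x | ∀ i, a i ⬝ᵥ x ≤ 1} := by
  ext ⟨x, y⟩
  constructor
  · rintro ⟨hle, heq⟩
    have hy : ∀ i, y i = (1 - a i ⬝ᵥ x) • w (jv i) := fun i => by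
      rw [← sub_eq_zero]
      refine hw3 (jv i) _ fun j' hj' => ?_
      have h := heq i j' hj'
      rw [dotProduct_sub, dotProduct_smul, hw1 _ _ hj', smul_eq_mul]
      dsimp only at h
      linarith
    refine ⟨x, fun i => ?_, by rw [wedgeEmbedding_apply, funext hy]⟩
    have h := hle i (jv i)
    dsimp only at h
    rw [hy i, dotProduct_smul, smul_eq_mul] at h
    nlinarith [hw2 (jv i)]
  · rintro ⟨x', hx, hxy⟩
    rw [wedgeEmbedding_apply, Prod.mk.injEq] at hxy
    obtain ⟨rfl, rfl⟩ := hxy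
    have heq : ∀ i, ∀ j', j' ≠ jv i →
        a i ⬝ᵥ x' + b j' ⬝ᵥ ((1 - a i ⬝ᵥ x') • w (jv i)) = 1 := fun i j' hj' => by
      rw [dotProduct_smul, hw1 _ _ hj', smul_eq_mul]
      ring
    refine ⟨fun i j => ?_, heq⟩
    by_cases hj : j = jv i
    · subst hj
      dsimp only
      rw [dotProduct_smul, smul_eq_mul]
      nlinarith [hw2 (jv i), hx i]
    · exact (heq i j hj).le

theorem isFaceOf_tight_inequalities {V S : Type*} [AddCommGroup V] [Module ℝ V] [Fintype S]
    (P : Set V) (c : S → V →ₗ[ℝ] ℝ) (T : Set S) (hP : ∀ z ∈ P, ∀ s, c s z ≤ 1) :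
    IsFaceOf {z ∈ P | ∀ s ∈ T, c s z = 1} P := by
  classical
  refine ⟨Set.sep_subset _ _, ∑ s with s ∈ T, c s, ∑ s with s ∈ T, 1, fun z hz => ?_, ?_⟩
  · rw [LinearMap.sum_apply]
    exact Finset.sum_le_sum fun s _ => hP z hz s
  · ext z
    refine and_congr_right fun hz => ?_
    rw [LinearMap.sum_apply, Finset.sum_eq_sum_iff_of_le fun s _ => hP z hz s]
    simp

/-- In the wedge product `W_{p,q-1} = C_p ⋈ Δ_{q-1}`, every face
corresponding to a vector `(j̄_0, …, j̄_{p-1})` (each entry the complement of a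
singleton) is a `p`-gon: a 2-dimensional face with `p` vertices and `p` edges.
There are exactly `q^p` such `p`-gon faces. -/
theorem wedgeProduct_pgon_simplex_pgon_faces
    (p q : ℕ) [NeZero p] [NeZero q] (hp : 3 ≤ p) (hq : 1 ≤ q)
    (a : ZMod p → Fin 2 → ℝ)
    (C : Set (Fin 2 → ℝ)) (hC : C = {x | ∀ i, a i ⬝ᵥ x ≤ 1})
    (hCbd : Bornology.IsBounded C) (hCdim : setDim C = 2)
    (hCfacets : ∀ i, IsFacetOf {x ∈ C | a i ⬝ᵥ x = 1} C)
    (hCinj : Function.Injective fun i => {x ∈ C | a i ⬝ᵥ x = 1})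
    (hCall : ∀ G, IsFacetOf G C → ∃ i, G = {x ∈ C | a i ⬝ᵥ x = 1})
    (hCcyc : ∀ i i' : ZMod p,
      (∃ v, {x ∈ C | a i ⬝ᵥ x = 1} ∩ {x ∈ C | a i' ⬝ᵥ x = 1} = {v}) ↔
        (i' = i + 1 ∨ i = i' + 1))
    (b : ZMod q → Fin (q - 1) → ℝ)
    (Δ : Set (Fin (q - 1) → ℝ)) (hΔ : Δ = {y | ∀ j, b j ⬝ᵥ y ≤ 1})
    (hΔbd : Bornology.IsBounded Δ) (hΔdim : setDim Δ = q - 1)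
    (hΔfacets : ∀ j, IsFacetOf {y ∈ Δ | b j ⬝ᵥ y = 1} Δ)
    (hΔinj : Function.Injective fun j => {y ∈ Δ | b j ⬝ᵥ y = 1})
    (hΔall : ∀ G, IsFacetOf G Δ → ∃ j, G = {y ∈ Δ | b j ⬝ᵥ y = 1})
    (hΔsimplex : ∀ j : ZMod q, ∃ w, IsVertexOf w Δ ∧
      {y ∈ Δ | ∀ j', j' ≠ j → b j' ⬝ᵥ y = 1} = {w})
    (W : Set ((Fin 2 → ℝ) × (ZMod p → Fin (q - 1) → ℝ)))
    (hW : W = {z | ∀ i j, a i ⬝ᵥ z.1 + b j ⬝ᵥ z.2 i ≤ 1})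
    -- the face of `W` corresponding to the vector `(j̄_0, …, j̄_{p-1})`:
    (G : (ZMod p → ZMod q) → Set ((Fin 2 → ℝ) × (ZMod p → Fin (q - 1) → ℝ)))
    (hG : ∀ jv, G jv =
      {z ∈ W | ∀ i, ∀ j', j' ≠ jv i → a i ⬝ᵥ z.1 + b j' ⬝ᵥ z.2 i = 1}) :
    (∀ jv : ZMod p → ZMod q,
      IsFaceOf (G jv) W ∧ setDim (G jv) = 2 ∧
      {v | IsVertexOf v (G jv)}.ncard = p ∧
      {e | IsFaceOf e (G jv) ∧ e.Nonempty ∧ setDim e = 1}.ncard = p) ∧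
    Function.Injective G ∧ (Set.range G).ncard = q ^ p := by
  have hw : ∀ j, ∃ w, {y ∈ {y | ∀ j, b j ⬝ᵥ y ≤ 1} | ∀ j', j' ≠ j → b j' ⬝ᵥ y = 1} = {w} :=
    fun j => by
      obtain ⟨w, -, h⟩ := hΔsimplex j
      exact ⟨w, hΔ ▸ h⟩
  choose w hw using hw
  have hvert := fun j => vertex_opposite_facet b (hΔ ▸ hΔbd) (hw j)
  have hGC : ∀ jv, G jv = wedgeEmbedding a (fun i => w (jv i)) '' C := fun jv => by
    rw [hG, hW, hC]
    exact wedge_face_eq_image a b jv w (fun j => (hvert j).1) (fun j => (hvert j).2.1)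
      fun j => (hvert j).2.2
  have hGinj : Function.Injective G := by
    intro jv jv' h
    by_contra hne
    obtain ⟨i, hi⟩ := Function.ne_iff.1 hne
    have h0 : wedgeEmbedding a (fun i => w (jv i)) 0 ∈ G jv := by
      rw [hGC]
      exact Set.mem_image_of_mem _ (by simp [hC])
    rw [h, hG] at h0
    have h1 := h0.2 i (jv i) hi
    simp only [wedgeEmbedding_apply, dotProduct_zero, sub_zero, one_smul, zero_add] at h1
    exact (hvert (jv i)).2.1.ne h1
  refine ⟨fun jv => ?_, hGinj, ?_⟩
  · have hleft : ∀ x, LinearMap.fst ℝ (Fin 2 → ℝ) (ZMod p → Fin (q - 1) → ℝ)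
        (wedgeEmbedding a (fun i => w (jv i)) x) = x := fun x => rfl
    have hinj : Function.Injective (wedgeEmbedding a (fun i => w (jv i))) :=
      Function.LeftInverse.injective hleft
    refine ⟨?_, ?_, ?_, ?_⟩
    · have hface := isFaceOf_tight_inequalities W
        (fun s : ZMod p × ZMod q =>
          dotProductBilin ℝ ℝ (a s.1) ∘ₗ LinearMap.fst ℝ (Fin 2 → ℝ) (ZMod p → Fin (q - 1) → ℝ) +
          dotProductBilin ℝ ℝ (b s.2) ∘ₗ LinearMap.proj s.1 ∘ₗ
            LinearMap.snd ℝ (Fin 2 → ℝ) (ZMod p → Fin (q - 1) → ℝ))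
        {s | s.2 ≠ jv s.1} (fun z hz s => by rw [hW] at hz; exact hz s.1 s.2)
      rw [hG]
      convert hface using 1
      ext z
      exact and_congr_right fun _ => ⟨fun h s hs => h s.1 s.2 hs, fun h i j hj => h (i, j) hj⟩
    · rw [hGC, setDim_image _ hinj, hCdim]
    · rw [hGC, setOf_isVertexOf_image _ _ hleft, Set.ncard_image_of_injective _ hinj]
      exact ncard_setOf_isVertexOf_polygon p hp a C hC hCbd hCinj hCcyc
    · rw [hGC, setOf_edges_image _ _ hleft, Set.ncard_image_of_injective _ hinj.image_injective]
      have hfacets : {e | IsFaceOf e C ∧ e.Nonempty ∧ setDim e = 1} =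
          Set.range fun i => {x ∈ C | a i ⬝ᵥ x = 1} := by
        ext e
        constructor
        · rintro ⟨he, hne, hd⟩
          obtain ⟨i, rfl⟩ := hCall e ⟨he, hne, by rw [hd, hCdim]⟩
          exact ⟨i, rfl⟩
        · rintro ⟨i, rfl⟩
          obtain ⟨he, hne, hd⟩ := hCfacets i
          exact ⟨he, hne, by rw [hCdim] at hd; exact Nat.succ_injective hd⟩
      rw [hfacets, ← Set.image_univ, Set.ncard_image_of_injective _ hCinj, Set.ncard_univ,
        Nat.card_zmod]
  · rw [← Set.image_univ, Set.ncard_image_of_injective _ hGinj, Set.ncard_univ, Nat.card_fun,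
      Nat.card_zmod, Nat.card_zmod]
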